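/- G_{f₀} is expansive on (X,d): there exists a constant ε > 0 such that for all x, y ∈ X with x ≠ y there exists n ∈ ℕ with d(G_{f₀}^n(x), G_{f₀}^n(y)) ≥ ε. -/

import Mathlib

open scoped BigOperators

/-- Sum of the discrete Boolean metric over the `N` coordinates (Hamming-type distance). -/
noncomputable def de (N : ℕ) (E F : Fin N → Bool) : ℝ :=
  ∑ k : Fin N, if E k = F k then (0 : ℝ) else 1

/-- Distance between strategies: `(9/N) Σ_k |S^k − Š^k| / 10^k`. -/
noncomputable def ds (N : ℕ) (S T : ℕ → Fin N) : ℝ :=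
  (9 / N) * ∑' k : ℕ, |((S k : ℕ) : ℝ) - ((T k : ℕ) : ℝ)| / 10 ^ (k + 1)

/-- The distance on the phase space `X = {1,…,N}^ℕ × B^N`. -/
noncomputable def dX (N : ℕ) (x y : (ℕ → Fin N) × (Fin N → Bool)) : ℝ :=
  de N x.2 y.2 + ds N x.1 y.1

/-- `F_f(k,E)` agrees with `E` except in coordinate `k`, where it equals `f(E)_k`. -/
def Ff (N : ℕ) (f : (Fin N → Bool) → (Fin N → Bool)) (k : Fin N) (E : Fin N → Bool) :
    Fin N → Bool :=
  fun j => if j = k then f E k else E j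

/-- `G_f(S,E) = (σ(S), F_f(S^1,E))`, where `σ` is the shift on strategies. -/
def G (N : ℕ) (f : (Fin N → Bool) → (Fin N → Bool))
    (x : (ℕ → Fin N) × (Fin N → Bool)) : (ℕ → Fin N) × (Fin N → Bool) :=
  (fun n => x.1 (n + 1), Ff N f (x.1 0) x.2)

/-- The vectorial negation `f₀`. -/
def f0 (N : ℕ) (E : Fin N → Bool) : Fin N → Bool := fun i => !(E i)

/-- A set is open for the metric `dX`. -/
def dOpen (N : ℕ) (U : Set ((ℕ → Fin N) × (Fin N → Bool))) : Prop :=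
  ∀ x ∈ U, ∃ ε > 0, ∀ y, dX N x y < ε → y ∈ U

/-- A set is closed for the metric `dX`. -/
def dClosed (N : ℕ) (A : Set ((ℕ → Fin N) × (Fin N → Bool))) : Prop :=
  dOpen N Aᶜ


theorem one_le_de {N : ℕ} {E F : Fin N → Bool} (h : E ≠ F) : 1 ≤ de N E F := by
  obtain ⟨k, hk⟩ := Function.ne_iff.mp h
  calc (1 : ℝ) = if E k = F k then (0 : ℝ) else 1 := by rw [if_neg hk]
    _ ≤ de N E F :=
      Finset.single_le_sum (f := fun k => if E k = F k then (0 : ℝ) else 1)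
        (fun i _ => by split_ifs <;> norm_num) (Finset.mem_univ k)

theorem ds_nonneg (N : ℕ) (S T : ℕ → Fin N) : 0 ≤ ds N S T :=
  mul_nonneg (by positivity) (tsum_nonneg fun k => by positivity)

theorem G_iterate_fst (N : ℕ) (f : (Fin N → Bool) → (Fin N → Bool)) (n k : ℕ)
    (x : (ℕ → Fin N) × (Fin N → Bool)) : ((G N f)^[n] x).1 k = x.1 (n + k) := by
  induction n generalizing k with
  | zero => simp
  | succ n ih =>
    rw [Function.iterate_succ_apply']
    change ((G N f)^[n] x).1 (k + 1) = _
    rw [ih, add_right_comm, add_assoc]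

theorem Ff_f0_injective_index {N : ℕ} (E : Fin N → Bool) :
    Function.Injective fun k => Ff N (f0 N) k E := by
  intro k l h
  by_contra hkl
  have := congrFun h k
  simp [Ff, f0, hkl] at this

/-- `G_{f₀}` is expansive on `(X,d)`. -/
theorem Gf0_expansive (N : ℕ) (hN : 2 ≤ N) :
    ∃ ε > (0 : ℝ), ∀ x y : (ℕ → Fin N) × (Fin N → Bool), x ≠ y →
      ∃ n : ℕ, ε ≤ dX N ((G N (f0 N))^[n] x) ((G N (f0 N))^[n] y) := by
  refine ⟨1, one_pos, fun x y hxy => ?_⟩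
  by_contra! hlt
  have hE (n : ℕ) : ((G N (f0 N))^[n] x).2 = ((G N (f0 N))^[n] y).2 := by
    by_contra hne
    exact (hlt n).not_ge (le_add_of_le_of_nonneg (one_le_de hne) (ds_nonneg N _ _))
  refine hxy (Prod.ext (funext fun n => ?_) (hE 0))
  have h := hE (n + 1)
  rw [Function.iterate_succ_apply', Function.iterate_succ_apply'] at h
  change Ff N (f0 N) _ _ = Ff N (f0 N) _ _ at h
  rw [hE n, G_iterate_fst, G_iterate_fst] at h
  exact Ff_f0_injective_index _ h
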